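/- For α_S ∈ (0,(d+1)/2) and α_T ∈ (0,1/2), the function (λ₁,λ₂,ω₁,ω₂) ↦ |F1_{[−1,1]}(ω₁+ω₂)|² |F1_K(λ₁+λ₂)|² ‖λ₁‖^{−(d+1−α_S)} ‖λ₂‖^{−(d+1−α_S)} |ω₁|^{−(1−α_T)} |ω₂|^{−(1−α_T)} is integrable over (ℝ^{d+1}×ℝ)², and its integral equals, up to the explicit constant [c(d+1,α_S,α_T)]^{−2}, the double integral ∫_{K×K}∫_{[−1,1]²} ‖x−y‖^{−2α_S} |t−s|^{−2α_T} dx dy dt ds, which is finite. -/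

import Mathlib

open MeasureTheory Set Complex
open scoped RealInnerProductSpace

theorem lintegral_rpow_mul_exp_neg_mul_Ioi {a r : ℝ} (ha : 0 < a) (hr : 0 < r) :
    ∫⁻ s in Ioi (0 : ℝ), ENNReal.ofReal (s ^ (a - 1) * Real.exp (-(r * s)))
      = ENNReal.ofReal (Real.Gamma a * r ^ (-a)) := by
  have hint : IntegrableOn (fun s : ℝ => s ^ (a - 1) * Real.exp (-(r * s))) (Ioi 0) := by
    simpa using integrableOn_rpow_mul_exp_neg_mul_rpow (s := a - 1) (p := 1) (b := r)
      (by linarith) one_pos hr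
  rw [← ofReal_integral_eq_lintegral_ofReal hint, Real.integral_rpow_mul_exp_neg_mul_Ioi ha hr,
    mul_comm, one_div, Real.inv_rpow hr.le, Real.rpow_neg hr.le]
  filter_upwards [ae_restrict_mem measurableSet_Ioi] with s (hs : 0 < s)
  exact mul_nonneg (by positivity) (by positivity)

theorem lintegral_rpow_mul_exp_neg_div_Ioi {b r : ℝ} (hb : 0 < b) (hr : 0 < r) :
    ∫⁻ s in Ioi (0 : ℝ), ENNReal.ofReal (s ^ (-b - 1) * Real.exp (-(r / s)))
      = ENNReal.ofReal (Real.Gamma b * r ^ (-b)) := by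
  have hint : IntegrableOn (fun s : ℝ => s ^ (b - 1) * Real.exp (-(r * s))) (Ioi 0) := by
    simpa using integrableOn_rpow_mul_exp_neg_mul_rpow (s := b - 1) (p := 1) (b := r)
      (by linarith) one_pos hr
  have heq : ∀ s ∈ Ioi (0 : ℝ), (|(-1 : ℝ)| * s ^ ((-1 : ℝ) - 1)) •
      ((s ^ (-1 : ℝ)) ^ (b - 1) * Real.exp (-(r * s ^ (-1 : ℝ))))
        = s ^ (-b - 1) * Real.exp (-(r / s)) := by
    intro s (hs : 0 < s)
    rw [← Real.rpow_mul hs.le, smul_eq_mul, abs_neg, abs_one, one_mul, ← mul_assoc,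
      ← Real.rpow_add hs, Real.rpow_neg_one, div_eq_mul_inv]
    ring_nf
  have hint' := (integrableOn_Ioi_comp_rpow_iff _ (p := -1) (by norm_num)).2 hint
  have hval := integral_comp_rpow_Ioi (fun s : ℝ => s ^ (b - 1) * Real.exp (-(r * s)))
    (p := -1) (by norm_num)
  rw [setIntegral_congr_fun measurableSet_Ioi heq, Real.integral_rpow_mul_exp_neg_mul_Ioi hb hr]
    at hval
  rw [integrableOn_congr_fun heq measurableSet_Ioi] at hint'
  rw [← ofReal_integral_eq_lintegral_ofReal hint', hval,
    mul_comm, one_div, Real.inv_rpow hr.le, Real.rpow_neg hr.le]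
  filter_upwards [ae_restrict_mem measurableSet_Ioi] with s (hs : 0 < s)
  exact mul_nonneg (by positivity) (by positivity)

theorem measurePreserving_prodProdProdComm {α β γ δ : Type*} [MeasurableSpace α]
    [MeasurableSpace β] [MeasurableSpace γ] [MeasurableSpace δ] (μa : Measure α) (μb : Measure β)
    (μc : Measure γ) (μd : Measure δ) [SFinite μa] [SFinite μb] [SFinite μc] [SFinite μd] :
    MeasurePreserving (fun p : (α × β) × (γ × δ) => ((p.1.1, p.2.1), (p.1.2, p.2.2)))
      ((μa.prod μb).prod (μc.prod μd)) ((μa.prod μc).prod (μb.prod μd)) := by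
  have h1 := measurePreserving_prodAssoc μa μb (μc.prod μd)
  have h2 := (measurePreserving_prodAssoc μb μc μd).symm
  have h3 := (Measure.measurePreserving_swap (μ := μb) (ν := μc)).prod (MeasurePreserving.id μd)
  have h4 := measurePreserving_prodAssoc μc μb μd
  have h5 := (measurePreserving_prodAssoc μa μc (μb.prod μd)).symm
  exact h5.comp (((MeasurePreserving.id μa).prod (h4.comp (h3.comp h2))).comp h1)

theorem integrable_and_integral_mul_prodProdProdComm {α β γ δ : Type*} [MeasurableSpace α]
    [MeasurableSpace β] [MeasurableSpace γ] [MeasurableSpace δ] {μa : Measure α} {μb : Measure β}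
    {μc : Measure γ} {μd : Measure δ} [SFinite μa] [SFinite μb] [SFinite μc] [SFinite μd]
    {f : α × γ → ℝ} {g : β × δ → ℝ} (hf : Integrable f (μa.prod μc))
    (hg : Integrable g (μb.prod μd)) :
    Integrable (fun p : (α × β) × (γ × δ) => f (p.1.1, p.2.1) * g (p.1.2, p.2.2))
      ((μa.prod μb).prod (μc.prod μd)) ∧
    ∫ p : (α × β) × (γ × δ), f (p.1.1, p.2.1) * g (p.1.2, p.2.2)
        ∂((μa.prod μb).prod (μc.prod μd))
      = (∫ x, f x ∂(μa.prod μc)) * ∫ y, g y ∂(μb.prod μd) := by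
  have hmp := measurePreserving_prodProdProdComm μa μb μc μd
  have hprod := hf.mul_prod hg
  refine ⟨hmp.integrable_comp_of_integrable hprod, ?_⟩
  have hmap := integral_map hmp.measurable.aemeasurable
    (hmp.map_eq.symm ▸ hprod.aestronglyMeasurable)
  rw [hmp.map_eq, integral_prod_mul] at hmap
  exact hmap.symm

section

variable {E : Type*} [NormedAddCommGroup E] [InnerProductSpace ℝ E] [FiniteDimensional ℝ E]
  [MeasurableSpace E] [BorelSpace E]

theorem integral_cexp_neg_mul_sq_norm_add_inner {s : ℝ} (hs : 0 < s) (z : E) :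
    ∫ v : E, cexp (-(s : ℂ) * ‖v‖ ^ 2 + I * (⟪z, v⟫ : ℝ))
      = (((Real.pi / s) ^ ((Module.finrank ℝ E : ℝ) / 2)
        * Real.exp (-(‖z‖ ^ 2 / 4 / s)) : ℝ) : ℂ) := by
  rw [GaussianFourier.integral_cexp_neg_mul_sq_norm_add (by simpa using hs)]
  push_cast
  rw [Complex.ofReal_cpow (by positivity)]
  push_cast
  congr 2
  rw [I_sq]
  field_simp

theorem lintegral_sq_norm_charFun_add_mul_gaussian (μ : Measure E) [IsFiniteMeasure μ] {s t : ℝ}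
    (hs : 0 < s) (ht : 0 < t) :
    ∫⁻ p : E × E, ENNReal.ofReal (‖charFun μ (p.1 + p.2)‖ ^ 2
        * (Real.exp (-(‖p.1‖ ^ 2 * s)) * Real.exp (-(‖p.2‖ ^ 2 * t))))
      = ∫⁻ q : E × E, ENNReal.ofReal
        (((Real.pi / s) ^ ((Module.finrank ℝ E : ℝ) / 2)
            * Real.exp (-(‖q.1 - q.2‖ ^ 2 / 4 / s)))
          * ((Real.pi / t) ^ ((Module.finrank ℝ E : ℝ) / 2)
            * Real.exp (-(‖q.1 - q.2‖ ^ 2 / 4 / t)))) ∂(μ.prod μ) := by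
  set g : ℝ → E → ℝ := fun r v => Real.exp (-(‖v‖ ^ 2 * r)) with hg
  have hgi : ∀ {r : ℝ}, 0 < r → Integrable (g r) := by
    intro r hr
    have := (GaussianFourier.integrable_cexp_neg_mul_sq_norm_add (V := E) (b := (r : ℂ))
      (by simpa using hr) 0 0).norm
    refine this.congr (.of_forall fun v => ?_)
    simp only [hg, Complex.norm_exp]
    norm_cast
    simp [mul_comm]
  set G : ℝ → E → ℝ := fun r z => (Real.pi / r) ^ ((Module.finrank ℝ E : ℝ) / 2)
    * Real.exp (-(‖z‖ ^ 2 / 4 / r)) with hG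
  have hG0 : ∀ {r : ℝ}, 0 < r → ∀ z, 0 ≤ G r z := fun {r} hr z => by positivity
  have hG1 : ∀ {r : ℝ}, 0 < r → ∀ z, G r z ≤ (Real.pi / r) ^ ((Module.finrank ℝ E : ℝ) / 2) := by
    intro r hr z
    refine mul_le_of_le_one_right (by positivity) (Real.exp_le_one_iff.2 ?_)
    have : 0 ≤ ‖z‖ ^ 2 / 4 / r := by positivity
    linarith
  have hintR : Integrable (fun q : E × E => G s (q.1 - q.2) * G t (q.1 - q.2)) (μ.prod μ) := by
    refine Integrable.of_bound (by fun_prop) ((Real.pi / s) ^ ((Module.finrank ℝ E : ℝ) / 2)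
      * (Real.pi / t) ^ ((Module.finrank ℝ E : ℝ) / 2)) (.of_forall fun q => ?_)
    rw [Real.norm_of_nonneg (mul_nonneg (hG0 hs _) (hG0 ht _))]
    exact mul_le_mul (hG1 hs _) (hG1 ht _) (hG0 ht _) (by positivity)
  have hgg : Integrable (fun p : E × E => g s p.1 * g t p.2) := (hgi hs).mul_prod (hgi ht)
  have hintL : Integrable (fun p : E × E => ‖charFun μ (p.1 + p.2)‖ ^ 2
      * (g s p.1 * g t p.2)) := by
    refine hgg.bdd_mul (c := μ.real univ ^ 2) ?_ (.of_forall fun p => ?_)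
    · have := measurable_charFun (μ := μ)
      exact Measurable.aestronglyMeasurable (by fun_prop)
    · rw [Real.norm_of_nonneg (by positivity)]
      exact pow_le_pow_left₀ (norm_nonneg _) (norm_charFun_le _) 2
  rw [← ofReal_integral_eq_lintegral_ofReal hintL (.of_forall fun p => by positivity),
    ← ofReal_integral_eq_lintegral_ofReal hintR
      (.of_forall fun q => mul_nonneg (hG0 hs _) (hG0 ht _))]
  congr 1
  rw [← Complex.ofReal_inj, ← integral_complex_ofReal, ← integral_complex_ofReal]
  set H : E × E → E × E → ℂ := fun p q =>
    cexp (⟪q.1, p.1 + p.2⟫ * I) * cexp (-(⟪q.2, p.1 + p.2⟫ * I)) * ((g s p.1 * g t p.2 : ℝ) : ℂ)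
    with hH
  have hHint : Integrable (Function.uncurry H) ((volume : Measure (E × E)).prod (μ.prod μ)) := by
    have h1 := hgg.mul_prod (integrable_const (1 : ℝ) (μ := μ.prod μ))
    refine h1.mono (Continuous.aestronglyMeasurable ?_) (.of_forall fun x => ?_)
    · simp only [hH, hg, Function.uncurry_def]
      fun_prop
    · simp only [hH, Function.uncurry_def, norm_mul, Complex.norm_exp, Complex.norm_real]
      simp
  have e1 : ∀ p : E × E, ((‖charFun μ (p.1 + p.2)‖ ^ 2 * (g s p.1 * g t p.2) : ℝ) : ℂ)
      = ∫ q, H p q ∂(μ.prod μ) := by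
    intro p
    simp only [hH]
    rw [integral_mul_const, integral_prod_mul (fun x => cexp (⟪x, p.1 + p.2⟫ * I))
      (fun x => cexp (-(⟪x, p.1 + p.2⟫ * I))), ← charFun_apply]
    have : ∫ x, cexp (-(⟪x, p.1 + p.2⟫ * I)) ∂μ = (starRingEnd ℂ) (charFun μ (p.1 + p.2)) := by
      rw [← charFun_neg, charFun_apply]
      simp only [inner_neg_right, Complex.ofReal_neg, neg_mul]
    rw [this, Complex.mul_conj, Complex.normSq_eq_norm_sq]
    push_cast
    rfl
  have e2 : ∀ q : E × E, ((G s (q.1 - q.2) * G t (q.1 - q.2) : ℝ) : ℂ) = ∫ p, H p q := by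
    intro q
    push_cast
    simp only [hG]
    rw [← integral_cexp_neg_mul_sq_norm_add_inner hs, ← integral_cexp_neg_mul_sq_norm_add_inner ht,
      ← integral_prod_mul, ← Measure.volume_eq_prod]
    refine integral_congr_ae (.of_forall fun p => ?_)
    simp only [hH, hg]
    push_cast
    rw [← Complex.exp_add, ← Complex.exp_add, ← Complex.exp_add, ← Complex.exp_add]
    congr 1
    simp only [inner_add_right, inner_sub_left]
    push_cast
    ring
  simp_rw [e1, e2]
  exact integral_integral_swap hHint

theorem lintegral_sq_norm_charFun_add_mul_rpow (μ : Measure E) [IsFiniteMeasure μ] [NullSingletonClass μ]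
    {α : ℝ} (hα : 0 < α) (hαn : α < Module.finrank ℝ E) :
    ∫⁻ p : E × E, ENNReal.ofReal (‖charFun μ (p.1 + p.2)‖ ^ 2
        * ‖p.1‖ ^ (-((Module.finrank ℝ E : ℝ) - α)) * ‖p.2‖ ^ (-((Module.finrank ℝ E : ℝ) - α)))
      = ENNReal.ofReal ((Real.Gamma (((Module.finrank ℝ E : ℝ) - α) / 2)
          / (2 ^ α * Real.pi ^ ((Module.finrank ℝ E : ℝ) / 2) * Real.Gamma (α / 2))) ^ (-2 : ℝ))
        * ∫⁻ q : E × E, ENNReal.ofReal (‖q.1 - q.2‖ ^ (-(2 * α))) ∂(μ.prod μ) := by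
  set n : ℝ := (Module.finrank ℝ E : ℝ)
  set a : ℝ := (n - α) / 2 with ha
  have ha0 : 0 < a := by rw [ha]; linarith
  have : Nontrivial E := by
    apply Module.nontrivial_of_finrank_pos (R := ℝ)
    have : (0 : ℝ) < Module.finrank ℝ E := hα.trans hαn
    exact_mod_cast this
  set ν : Measure ℝ := volume.restrict (Ioi 0) with hν
  have hνpos : ∀ᵐ st ∂(ν.prod ν), 0 < st.1 ∧ 0 < st.2 := by
    have h : ∀ᵐ s ∂ν, 0 < s := ae_restrict_mem measurableSet_Ioi
    filter_upwards [Measure.quasiMeasurePreserving_fst.ae h,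
      Measure.quasiMeasurePreserving_snd.ae h] with st h1 h2 using ⟨h1, h2⟩
  have hprod : ∀ f : ℝ → ℝ, Measurable f → (∀ s, 0 < s → 0 ≤ f s) → ∀ g : ℝ → ℝ, Measurable g →
      ∫⁻ st, ENNReal.ofReal (f st.1 * g st.2) ∂(ν.prod ν)
        = (∫⁻ s, ENNReal.ofReal (f s) ∂ν) * ∫⁻ s, ENNReal.ofReal (g s) ∂ν := by
    intro f hf hf0 g hg
    rw [← lintegral_prod_mul (by fun_prop) (by fun_prop)]
    refine lintegral_congr_ae ?_
    filter_upwards [hνpos] with st hst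
    rw [ENNReal.ofReal_mul (hf0 _ hst.1)]
  have hcf := measurable_charFun (μ := μ)
  set Γa : ℝ := Real.Gamma a
  have hΓa0 : 0 < Γa := Real.Gamma_pos_of_pos ha0
  set Γb : ℝ := Real.Gamma (α / 2)
  have hΓb0 : 0 < Γb := Real.Gamma_pos_of_pos (by linarith)
  have hL : ∫⁻ p : E × E, ENNReal.ofReal (‖charFun μ (p.1 + p.2)‖ ^ 2
        * ((Γa * ‖p.1‖ ^ (-(n - α))) * (Γa * ‖p.2‖ ^ (-(n - α)))))
      = ∫⁻ p : E × E, ∫⁻ st, ENNReal.ofReal (‖charFun μ (p.1 + p.2)‖ ^ 2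
        * ((st.1 ^ (a - 1) * Real.exp (-(‖p.1‖ ^ 2 * st.1)))
          * (st.2 ^ (a - 1) * Real.exp (-(‖p.2‖ ^ 2 * st.2))))) ∂(ν.prod ν) := by
    have h0 : ∀ᵐ v : E, v ≠ 0 := Measure.ae_ne volume 0
    refine lintegral_congr_ae ?_
    filter_upwards [Measure.quasiMeasurePreserving_fst.ae h0,
      Measure.quasiMeasurePreserving_snd.ae h0] with p h1 h2
    have key : ∀ v : E, v ≠ 0 → ENNReal.ofReal (Γa * ‖v‖ ^ (-(n - α)))
        = ∫⁻ s, ENNReal.ofReal (s ^ (a - 1) * Real.exp (-(‖v‖ ^ 2 * s))) ∂ν := by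
      intro v hv
      have hv0 : 0 < ‖v‖ := norm_pos_iff.2 hv
      rw [hν, lintegral_rpow_mul_exp_neg_mul_Ioi ha0 (by positivity), ← Real.rpow_natCast,
        ← Real.rpow_mul hv0.le]
      congr 3
      rw [ha]; push_cast; ring
    simp_rw [fun x : ℝ => ENNReal.ofReal_mul (q := x) (sq_nonneg ‖charFun μ (p.1 + p.2)‖)]
    rw [lintegral_const_mul _ (by fun_prop),
      hprod (fun s => s ^ (a - 1) * Real.exp (-(‖p.1‖ ^ 2 * s))) (by fun_prop)
        (fun s hs => by positivity)
        (fun s => s ^ (a - 1) * Real.exp (-(‖p.2‖ ^ 2 * s))) (by fun_prop), ← key _ h1,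
      ← key _ h2, ENNReal.ofReal_mul (p := Γa * _) (by positivity)]
  have hR : ∫⁻ q : E × E, ENNReal.ofReal ((Real.pi ^ (n / 2) * 2 ^ α * Γb) ^ 2
        * ‖q.1 - q.2‖ ^ (-(2 * α))) ∂(μ.prod μ)
      = ∫⁻ q : E × E, ∫⁻ st, ENNReal.ofReal (
        (st.1 ^ (a - 1) * ((Real.pi / st.1) ^ (n / 2) * Real.exp (-(‖q.1 - q.2‖ ^ 2 / 4 / st.1))))
        * (st.2 ^ (a - 1)
          * ((Real.pi / st.2) ^ (n / 2) * Real.exp (-(‖q.1 - q.2‖ ^ 2 / 4 / st.2)))))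
        ∂(ν.prod ν) ∂(μ.prod μ) := by
    have h0 : ∀ᵐ q ∂(μ.prod μ), q.1 - q.2 ≠ 0 := by
      rw [Measure.ae_prod_iff_ae_ae]
      · refine .of_forall fun x => ?_
        filter_upwards [Measure.ae_ne μ x] with y hy
        exact sub_ne_zero.2 hy.symm
      · exact (measurableSet_singleton (0 : E)).compl.preimage (by fun_prop)
    refine lintegral_congr_ae ?_
    filter_upwards [h0] with q hq
    have hv0 : 0 < ‖q.1 - q.2‖ := norm_pos_iff.2 hq
    rw [hprod (fun s => s ^ (a - 1)
      * ((Real.pi / s) ^ (n / 2) * Real.exp (-(‖q.1 - q.2‖ ^ 2 / 4 / s)))) (by fun_prop)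
      (fun s hs => by positivity) (fun s => s ^ (a - 1)
      * ((Real.pi / s) ^ (n / 2) * Real.exp (-(‖q.1 - q.2‖ ^ 2 / 4 / s)))) (by fun_prop)]
    have key : ∫⁻ s, ENNReal.ofReal (s ^ (a - 1)
        * ((Real.pi / s) ^ (n / 2) * Real.exp (-(‖q.1 - q.2‖ ^ 2 / 4 / s)))) ∂ν
        = ENNReal.ofReal (Real.pi ^ (n / 2) * 2 ^ α * Γb * ‖q.1 - q.2‖ ^ (-α)) := by
      have : ∀ s ∈ Ioi (0 : ℝ), ENNReal.ofReal (s ^ (a - 1)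
          * ((Real.pi / s) ^ (n / 2) * Real.exp (-(‖q.1 - q.2‖ ^ 2 / 4 / s))))
          = ENNReal.ofReal (Real.pi ^ (n / 2)) * ENNReal.ofReal (s ^ (-(α / 2) - 1)
            * Real.exp (-(‖q.1 - q.2‖ ^ 2 / 4 / s))) := by
        intro s (hs : 0 < s)
        rw [← ENNReal.ofReal_mul (by positivity), Real.div_rpow Real.pi_pos.le hs.le,
          show -(α / 2) - 1 = a - 1 - n / 2 by rw [ha]; ring, Real.rpow_sub hs (a - 1)]
        congr 1
        ring
      rw [hν, setLIntegral_congr_fun measurableSet_Ioi this, lintegral_const_mul _ (by fun_prop),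
        lintegral_rpow_mul_exp_neg_div_Ioi (by linarith) (by positivity),
        ← ENNReal.ofReal_mul (by positivity)]
      congr 1
      have h4 : (‖q.1 - q.2‖ ^ 2 / 4) ^ (-(α / 2)) = 2 ^ α * ‖q.1 - q.2‖ ^ (-α) := by
        rw [show ‖q.1 - q.2‖ ^ 2 / 4 = (‖q.1 - q.2‖ / 2) ^ (2 : ℝ) by
          rw [Real.rpow_two]; ring, ← Real.rpow_mul (by positivity),
          show 2 * -(α / 2) = -α by ring, Real.div_rpow hv0.le zero_le_two,
          Real.rpow_neg zero_le_two, div_inv_eq_mul, mul_comm]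
      rw [h4]
      ring
    rw [key, ← ENNReal.ofReal_mul (by positivity), show -(2 * α) = -α + -α by ring,
      Real.rpow_add hv0]
    congr 1
    ring
  have hLR : ∫⁻ p : E × E, ENNReal.ofReal (‖charFun μ (p.1 + p.2)‖ ^ 2
        * ((Γa * ‖p.1‖ ^ (-(n - α))) * (Γa * ‖p.2‖ ^ (-(n - α)))))
      = ∫⁻ q : E × E, ENNReal.ofReal ((Real.pi ^ (n / 2) * 2 ^ α * Γb) ^ 2
        * ‖q.1 - q.2‖ ^ (-(2 * α))) ∂(μ.prod μ) := by
    rw [hL, hR, lintegral_lintegral_swap (μ := volume) (by fun_prop),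
      lintegral_lintegral_swap (μ := μ.prod μ) (by fun_prop)]
    refine lintegral_congr_ae ?_
    filter_upwards [hνpos] with st ⟨h1, h2⟩
    have := congrArg (ENNReal.ofReal (st.1 ^ (a - 1) * st.2 ^ (a - 1)) * ·)
      (lintegral_sq_norm_charFun_add_mul_gaussian μ h1 h2)
    rw [← lintegral_const_mul _ (by fun_prop), ← lintegral_const_mul _ (by fun_prop)] at this
    simp_rw [← ENNReal.ofReal_mul (show 0 ≤ st.1 ^ (a - 1) * st.2 ^ (a - 1) by positivity)] at this
    convert this using 4 <;> ring
  have hconst : (Γa / (2 ^ α * Real.pi ^ (n / 2) * Γb)) ^ (-2 : ℝ)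
      = (Γa ^ 2)⁻¹ * (Real.pi ^ (n / 2) * 2 ^ α * Γb) ^ 2 := by
    rw [Real.rpow_neg (by positivity), Real.rpow_two]
    field_simp
  rw [hconst, ENNReal.ofReal_mul (by positivity), mul_assoc,
    ← lintegral_const_mul _ (by fun_prop)]
  simp_rw [← ENNReal.ofReal_mul (sq_nonneg (Real.pi ^ (n / 2) * 2 ^ α * Γb))]
  rw [← hLR, ← lintegral_const_mul _ (by fun_prop)]
  simp_rw [← ENNReal.ofReal_mul (inv_nonneg.2 (sq_nonneg Γa))]
  congr with p
  congr 1
  field_simp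

theorem integrable_norm_sub_rpow_neg {K : Set E} (hK : Bornology.IsBounded K)
    (hKm : MeasurableSet K) {β : ℝ} (hd : 1 ≤ Module.finrank ℝ E) (hβ : β < Module.finrank ℝ E) :
    Integrable (fun q : E × E => ‖q.1 - q.2‖ ^ (-β))
      ((volume.restrict K).prod (volume.restrict K)) := by
  obtain ⟨R, hR0, hR⟩ := hK.exists_pos_norm_lt
  set B : Set E := Metric.ball 0 (R + R) with hBdef
  have hB : IntegrableOn (fun v : E => ‖v‖ ^ (-β)) B volume :=
    integrableOn_ball_of_norm_le_rpow hd (C := 1) hβ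
      (.of_forall fun x => by rw [Real.norm_of_nonneg (by positivity), one_mul])
      (Measurable.aestronglyMeasurable (by fun_prop))
  refine ⟨Measurable.aestronglyMeasurable (by fun_prop), ?_⟩
  rw [HasFiniteIntegral, lintegral_prod _ (by fun_prop)]
  have hle : ∀ x ∈ K, ∫⁻ y in K, ‖‖x - y‖ ^ (-β)‖ₑ ≤ ∫⁻ v in B, ‖‖v‖ ^ (-β)‖ₑ := by
    intro x hx
    rw [← lintegral_indicator Metric.isOpen_ball.measurableSet,
      ← lintegral_sub_left_eq_self (B.indicator fun v => ‖‖v‖ ^ (-β)‖ₑ) x]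
    refine (setLIntegral_mono' hKm fun y hy => ?_).trans (setLIntegral_le_lintegral K _)
    rw [indicator_of_mem]
    rw [hBdef, mem_ball_zero_iff]
    exact (norm_sub_le x y).trans_lt (add_lt_add (hR x hx) (hR y hy))
  refine (setLIntegral_mono' hKm hle).trans_lt ?_
  rw [setLIntegral_const]
  exact ENNReal.mul_lt_top hB.2 hK.measure_lt_top

theorem integrable_and_integral_sq_norm_fourier_add_mul_rpow {K : Set E}
    (hK : Bornology.IsBounded K) (hKm : MeasurableSet K) {α : ℝ} (hα : 0 < α)
    (hαn : 2 * α < Module.finrank ℝ E) :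
    Integrable (fun p : E × E => ‖∫ x in K, cexp (-(I * (⟪p.1 + p.2, x⟫ : ℝ)))‖ ^ 2
        * ‖p.1‖ ^ (-((Module.finrank ℝ E : ℝ) - α)) * ‖p.2‖ ^ (-((Module.finrank ℝ E : ℝ) - α))) ∧
    ∫ p : E × E, ‖∫ x in K, cexp (-(I * (⟪p.1 + p.2, x⟫ : ℝ)))‖ ^ 2
        * ‖p.1‖ ^ (-((Module.finrank ℝ E : ℝ) - α)) * ‖p.2‖ ^ (-((Module.finrank ℝ E : ℝ) - α))
      = (Real.Gamma (((Module.finrank ℝ E : ℝ) - α) / 2)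
          / (2 ^ α * Real.pi ^ ((Module.finrank ℝ E : ℝ) / 2) * Real.Gamma (α / 2))) ^ (-2 : ℝ)
        * ∫ q : E × E, ‖q.1 - q.2‖ ^ (-(2 * α))
          ∂((volume.restrict K).prod (volume.restrict K)) := by
  have hpos : (0 : ℝ) < Module.finrank ℝ E := by linarith
  have hd : 1 ≤ Module.finrank ℝ E := by exact_mod_cast hpos
  have : Nontrivial E := Module.nontrivial_of_finrank_pos (R := ℝ) hd
  have : IsFiniteMeasure (volume.restrict K) := ⟨by simpa using hK.measure_lt_top⟩
  have hphi : ∀ l : E, ‖∫ x in K, cexp (-(I * (⟪l, x⟫ : ℝ)))‖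
      = ‖charFun (volume.restrict K) l‖ := by
    intro l
    rw [← Complex.norm_conj (charFun _ l), ← charFun_neg, charFun_apply]
    simp only [inner_neg_right, Complex.ofReal_neg, neg_mul, mul_comm I, real_inner_comm l]
  simp_rw [hphi]
  have hcf := measurable_charFun (μ := volume.restrict K)
  have hint := integrable_norm_sub_rpow_neg hK hKm hd hαn
  have key := lintegral_sq_norm_charFun_add_mul_rpow (volume.restrict K) hα
    (show α < Module.finrank ℝ E by linarith)
  have hG1 : 0 < Real.Gamma (((Module.finrank ℝ E : ℝ) - α) / 2) :=
    Real.Gamma_pos_of_pos (by linarith)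
  have hG2 : 0 < Real.Gamma (α / 2) := Real.Gamma_pos_of_pos (by linarith)
  rw [← ofReal_integral_eq_lintegral_ofReal hint (.of_forall fun q => by positivity),
    ← ENNReal.ofReal_mul (by positivity)] at key
  have hmeas : AEStronglyMeasurable (fun p : E × E => ‖charFun (volume.restrict K) (p.1 + p.2)‖ ^ 2
      * ‖p.1‖ ^ (-((Module.finrank ℝ E : ℝ) - α)) * ‖p.2‖ ^ (-((Module.finrank ℝ E : ℝ) - α))) :=
    Measurable.aestronglyMeasurable (by fun_prop)
  refine ⟨(lintegral_ofReal_ne_top_iff_integrable hmeas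
    (.of_forall fun p => by positivity)).1 (by rw [key]; exact ENNReal.ofReal_ne_top), ?_⟩
  rw [integral_eq_lintegral_of_nonneg_ae (.of_forall fun p => by positivity) hmeas, key,
    ENNReal.toReal_ofReal (mul_nonneg (by positivity) (integral_nonneg fun q => by positivity))]

end


/-- for `α_S ∈ (0,(d+1)/2)` and `α_T ∈ (0,1/2)`, and `K ⊂ ℝ^{d+1}` compact convex
with positive Lebesgue measure, the function
`(λ₁,λ₂,ω₁,ω₂) ↦ |F1_{[−1,1]}(ω₁+ω₂)|² |F1_K(λ₁+λ₂)|² ‖λ₁‖^{−(d+1−α_S)} ‖λ₂‖^{−(d+1−α_S)}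
  |ω₁|^{−(1−α_T)} |ω₂|^{−(1−α_T)}`
is integrable over `(ℝ^{d+1}×ℝ)²`, and its integral equals, up to the explicit Riesz constant
`c(d+1,α_S,α_T)^{−2}`, the finite double integral
`∫_{K×K}∫_{[−1,1]²} ‖x−y‖^{−2α_S}|t−s|^{−2α_T} dx dy dt ds`. -/
theorem spectral_integral_riesz_identity (d : ℕ) (αS αT : ℝ)
    (hαS : 0 < αS ∧ αS < (d + 1) / 2) (hαT : 0 < αT ∧ αT < 1 / 2)
    (K : Set (EuclideanSpace ℝ (Fin (d + 1)))) (hKc : IsCompact K) (hKconv : Convex ℝ K)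
    (hKpos : 0 < volume K) :
    Integrable
      (fun p : (EuclideanSpace ℝ (Fin (d + 1)) × ℝ) × (EuclideanSpace ℝ (Fin (d + 1)) × ℝ) =>
        ‖∫ t in Icc (-1 : ℝ) 1, Complex.exp (-(Complex.I * ((p.1.2 + p.2.2) * t)))‖ ^ 2
          * ‖∫ x in K, Complex.exp (-(Complex.I * (⟪p.1.1 + p.2.1, x⟫ : ℝ)))‖ ^ 2
          * ‖p.1.1‖ ^ (-((d : ℝ) + 1 - αS)) * ‖p.2.1‖ ^ (-((d : ℝ) + 1 - αS))
          * |p.1.2| ^ (-(1 - αT)) * |p.2.2| ^ (-(1 - αT))) volume ∧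
    ((∫ p : (EuclideanSpace ℝ (Fin (d + 1)) × ℝ) × (EuclideanSpace ℝ (Fin (d + 1)) × ℝ),
        ‖∫ t in Icc (-1 : ℝ) 1, Complex.exp (-(Complex.I * ((p.1.2 + p.2.2) * t)))‖ ^ 2
          * ‖∫ x in K, Complex.exp (-(Complex.I * (⟪p.1.1 + p.2.1, x⟫ : ℝ)))‖ ^ 2
          * ‖p.1.1‖ ^ (-((d : ℝ) + 1 - αS)) * ‖p.2.1‖ ^ (-((d : ℝ) + 1 - αS))
          * |p.1.2| ^ (-(1 - αT)) * |p.2.2| ^ (-(1 - αT)))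
      = ((Real.Gamma (((d : ℝ) + 1 - αS) / 2)
            / (2 ^ αS * Real.pi ^ (((d : ℝ) + 1) / 2) * Real.Gamma (αS / 2)))
          * (Real.Gamma ((1 - αT) / 2)
            / (2 ^ αT * Real.pi ^ ((1 : ℝ) / 2) * Real.Gamma (αT / 2)))) ^ (-2 : ℝ)
        * ∫ x in K, ∫ y in K, ∫ t in Icc (-1 : ℝ) 1, ∫ s in Icc (-1 : ℝ) 1,
            ‖x - y‖ ^ (-(2 * αS)) * |t - s| ^ (-(2 * αT))) ∧
    Integrable
      (fun q : (EuclideanSpace ℝ (Fin (d + 1)) × EuclideanSpace ℝ (Fin (d + 1))) × ℝ × ℝ =>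
        ‖q.1.1 - q.1.2‖ ^ (-(2 * αS)) * |q.2.1 - q.2.2| ^ (-(2 * αT)))
      (((volume.restrict K).prod (volume.restrict K)).prod
        ((volume.restrict (Icc (-1 : ℝ) 1)).prod (volume.restrict (Icc (-1 : ℝ) 1)))) := by
  have hfr : (Module.finrank ℝ (EuclideanSpace ℝ (Fin (d + 1))) : ℝ) = (d : ℝ) + 1 := by simp
  have hI : Bornology.IsBounded (Icc (-1 : ℝ) 1) := Metric.isBounded_Icc _ _
  obtain ⟨hS1, hS2⟩ := integrable_and_integral_sq_norm_fourier_add_mul_rpow hKc.isBounded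
    hKc.measurableSet hαS.1 (by rw [hfr]; linarith)
  obtain ⟨hT1, hT2⟩ := integrable_and_integral_sq_norm_fourier_add_mul_rpow hI
    measurableSet_Icc hαT.1 (by rw [Module.finrank_self, Nat.cast_one]; linarith)
  have hS3 := integrable_norm_sub_rpow_neg hKc.isBounded hKc.measurableSet (β := 2 * αS)
    (by simp) (by rw [hfr]; linarith)
  have hT3 := integrable_norm_sub_rpow_neg hI measurableSet_Icc (β := 2 * αT)
    (by simp) (by rw [Module.finrank_self, Nat.cast_one]; linarith)
  simp only [hfr] at hS1 hS2
  simp only [Module.finrank_self, Nat.cast_one, Real.norm_eq_abs] at hT1 hT2 hT3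
  set C1 := Real.Gamma (((d : ℝ) + 1 - αS) / 2)
    / (2 ^ αS * Real.pi ^ (((d : ℝ) + 1) / 2) * Real.Gamma (αS / 2))
  set C2 := Real.Gamma ((1 - αT) / 2)
    / (2 ^ αT * Real.pi ^ ((1 : ℝ) / 2) * Real.Gamma (αT / 2))
  have hC1' : 0 ≤ C1 := by
    have h1 : 0 < Real.Gamma (((d : ℝ) + 1 - αS) / 2) := Real.Gamma_pos_of_pos (by linarith)
    have h2 : 0 < Real.Gamma (αS / 2) := Real.Gamma_pos_of_pos (by linarith)
    positivity
  have hC2' : 0 ≤ C2 := by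
    have h1 : 0 < Real.Gamma ((1 - αT) / 2) := Real.Gamma_pos_of_pos (by linarith)
    have h2 : 0 < Real.Gamma (αT / 2) := Real.Gamma_pos_of_pos (by linarith)
    positivity
  obtain ⟨hint, hval⟩ := integrable_and_integral_mul_prodProdProdComm hS1 hT1
  have hfun : (fun p : (EuclideanSpace ℝ (Fin (d + 1)) × ℝ) ×
        (EuclideanSpace ℝ (Fin (d + 1)) × ℝ) =>
        ‖∫ t in Icc (-1 : ℝ) 1, Complex.exp (-(Complex.I * ((p.1.2 + p.2.2) * t)))‖ ^ 2
          * ‖∫ x in K, Complex.exp (-(Complex.I * (⟪p.1.1 + p.2.1, x⟫ : ℝ)))‖ ^ 2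
          * ‖p.1.1‖ ^ (-((d : ℝ) + 1 - αS)) * ‖p.2.1‖ ^ (-((d : ℝ) + 1 - αS))
          * |p.1.2| ^ (-(1 - αT)) * |p.2.2| ^ (-(1 - αT)))
      = fun p => (‖∫ x in K, cexp (-(I * (⟪p.1.1 + p.2.1, x⟫ : ℝ)))‖ ^ 2
          * ‖p.1.1‖ ^ (-((d : ℝ) + 1 - αS)) * ‖p.2.1‖ ^ (-((d : ℝ) + 1 - αS)))
        * (‖∫ t in Icc (-1 : ℝ) 1, cexp (-(I * (⟪p.1.2 + p.2.2, t⟫ : ℝ)))‖ ^ 2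
          * |p.1.2| ^ (-(1 - αT)) * |p.2.2| ^ (-(1 - αT))) := by
    funext p
    have : ∀ t : ℝ, ((⟪p.1.2 + p.2.2, t⟫ : ℝ) : ℂ) = ((p.1.2 : ℂ) + p.2.2) * t := by
      intro t
      simp only [RCLike.inner_apply, conj_trivial]
      push_cast
      ring
    simp only [this]
    ring
  rw [hfun]
  refine ⟨hint, hval.trans ?_, hS3.mul_prod hT3⟩
  rw [← Measure.volume_eq_prod, ← Measure.volume_eq_prod, hS2, hT2, integral_prod _ hS3,
    integral_prod _ hT3, Real.mul_rpow hC1' hC2']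
  simp_rw [integral_const_mul, integral_mul_const]
  ring
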